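/- Let N be a rooted phylogenetic network that represents a cluster set C on a finite taxa set X. Then there exists an ST-set tree sequence of C of length exactly r(N), in which the ST-sets are allowed to be empty (the sequence is obtained by successively removing subtrees below reticulations from N until a tree remains). -/

import Mathlib

open scoped Classical

namespace Phylo

variable {α : Type} [DecidableEq α]

/-- A finite directed graph whose vertices carry labels from `α`; used to model
rooted phylogenetic networks and trees. -/
structure Net (α : Type) where
  n : ℕ
  E : Finset (Fin n × Fin n)
  label : Fin n → α

namespace Net

def indeg (N : Net α) (v : Fin N.n) : ℕ := (N.E.filter fun e => e.2 = v).card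

def outdeg (N : Net α) (v : Fin N.n) : ℕ := (N.E.filter fun e => e.1 = v).card

def Adj (N : Net α) (u v : Fin N.n) : Prop := (u, v) ∈ N.E

def Reaches (N : Net α) : Fin N.n → Fin N.n → Prop := Relation.ReflTransGen N.Adj

def IsLeaf (N : Net α) (v : Fin N.n) : Prop := N.outdeg v = 0

/-- The set of labels of leaves reachable from `v` by directed paths. -/
noncomputable def clusterBelow (N : Net α) (v : Fin N.n) : Finset α :=
  (Finset.univ.filter fun w => N.Reaches v w ∧ N.IsLeaf w).image N.label

/-- The reticulation number `r(N) = Σ_{v : indeg(v) > 0} (indeg(v) - 1)`. -/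
def reticNum (N : Net α) : ℕ := ∑ v, (N.indeg v - 1)

end Net

/-- `N` is a rooted phylogenetic network on the taxa set `X`: an acyclic digraph with a
unique root (indegree-0 node), no node with indegree 1 and outdegree 1, every
reticulation (indegree ≥ 2) having outdegree ≥ 1, and leaves bijectively labeled by `X`. -/
def IsPhyloNet (X : Finset α) (N : Net α) : Prop :=
  (∀ v : Fin N.n, ¬ Relation.TransGen N.Adj v v) ∧
  (∃! ρ : Fin N.n, N.indeg ρ = 0) ∧
  (∀ v : Fin N.n, ¬ (N.indeg v = 1 ∧ N.outdeg v = 1)) ∧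
  (∀ v : Fin N.n, 2 ≤ N.indeg v → 1 ≤ N.outdeg v) ∧
  Set.BijOn N.label {v | N.IsLeaf v} (X : Set α)

/-- A rooted phylogenetic tree on `X` is a network on `X` with reticulation number 0. -/
def IsPhyloTree (X : Finset α) (N : Net α) : Prop := IsPhyloNet X N ∧ N.reticNum = 0

/-- A network is binary if every reticulation has indegree 2 and outdegree 1 and every
non-leaf tree node has outdegree 2. -/
def IsBinary (N : Net α) : Prop :=
  ∀ v : Fin N.n, (N.indeg v ≤ 1 → N.outdeg v = 0 ∨ N.outdeg v = 2) ∧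
    (2 ≤ N.indeg v → N.indeg v = 2 ∧ N.outdeg v = 1)

/-- The internal vertices of a path given as a list of vertices. -/
def internals {β : Type*} (p : List β) : List β := p.tail.dropLast

def IsDirPath (N : Net α) (u v : Fin N.n) (p : List (Fin N.n)) : Prop :=
  p.head? = some u ∧ p.getLast? = some v ∧ p.Chain' N.Adj ∧ 2 ≤ p.length

/-- `N` displays `T`: `T` can be obtained from `N` by deleting nodes and edges and
suppressing indegree-1 outdegree-1 nodes, formalized as a topological embedding:
each edge of `T` maps to a directed path of `N`, paths being internally disjoint
from each other and from the images of the nodes of `T`, and leaves of `T` map to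
leaves of `N` with the same label. -/
def Displays (N T : Net α) : Prop :=
  ∃ φ : Fin T.n → Fin N.n, Function.Injective φ ∧
    (∀ v, T.IsLeaf v → N.IsLeaf (φ v) ∧ N.label (φ v) = T.label v) ∧
    ∃ P : Fin T.n × Fin T.n → List (Fin N.n),
      (∀ e ∈ T.E, IsDirPath N (φ e.1) (φ e.2) (P e)) ∧
      (∀ e ∈ T.E, ∀ w ∈ internals (P e), w ∉ Set.range φ) ∧
      (∀ e ∈ T.E, ∀ f ∈ T.E, e ≠ f → ∀ w ∈ internals (P e), w ∉ internals (P f))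

/-- `N` represents the cluster `C` in the softwired sense: some tree on `X` displayed by
`N` has an edge whose set of leaf descendants is exactly `C`. -/
def RepresentsCluster (X : Finset α) (N : Net α) (C : Finset α) : Prop :=
  ∃ T : Net α, IsPhyloTree X T ∧ Displays N T ∧ ∃ e ∈ T.E, T.clusterBelow e.2 = C

def RepresentsSet (X : Finset α) (N : Net α) (𝒞 : Set (Finset α)) : Prop :=
  ∀ C ∈ 𝒞, RepresentsCluster X N C

/-- `Cl(T)`: the set of clusters represented by edges of the tree `T`. -/
def clSet (T : Net α) : Set (Finset α) := {C | ∃ e ∈ T.E, T.clusterBelow e.2 = C}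

/-- `r(𝒞)`: the minimum reticulation number of a network on `X` representing `𝒞`. -/
noncomputable def rNum (X : Finset α) (𝒞 : Set (Finset α)) : ℕ :=
  sInf {k | ∃ N : Net α, IsPhyloNet X N ∧ RepresentsSet X N 𝒞 ∧ N.reticNum = k}

/-- A cluster on `X` is a nonempty proper subset of `X`. -/
def IsCluster (X C : Finset α) : Prop := C ⊆ X ∧ C.Nonempty ∧ C ≠ X

def IsClusterSet (X : Finset α) (𝒞 : Set (Finset α)) : Prop := ∀ C ∈ 𝒞, IsCluster X C

def Compatible (A B : Finset α) : Prop := A ∩ B = ∅ ∨ A ⊆ B ∨ B ⊆ A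

/-- `𝒞 \ S`: remove the elements of `S` from each cluster, discarding emptied clusters. -/
def removeTaxa (𝒞 : Set (Finset α)) (S : Finset α) : Set (Finset α) :=
  {D | D.Nonempty ∧ ∃ C ∈ 𝒞, D = C \ S}

/-- `𝒞 | S`: the restriction of `𝒞` to `S`. -/
def restrictTo (𝒞 : Set (Finset α)) (S : Finset α) : Set (Finset α) :=
  {D | D.Nonempty ∧ ∃ C ∈ 𝒞, D = C ∩ S}

/-- `S` is unseparated by `𝒞`: no cluster of `𝒞` is incompatible with `S`. -/
def Unseparated (𝒞 : Set (Finset α)) (S : Finset α) : Prop := ∀ C ∈ 𝒞, Compatible C S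

/-- `𝒞` separates every proper subset of `X` with at least two elements. -/
def Separating (X : Finset α) (𝒞 : Set (Finset α)) : Prop :=
  ∀ X' : Finset α, X' ⊂ X → 2 ≤ X'.card → ∃ C ∈ 𝒞, ¬ Compatible C X'

def PairwiseCompatible (𝒞 : Set (Finset α)) : Prop := ∀ A ∈ 𝒞, ∀ B ∈ 𝒞, Compatible A B

/-- `S` is an ST-set with respect to `𝒞`. -/
def IsSTSet (X : Finset α) (𝒞 : Set (Finset α)) (S : Finset α) : Prop :=
  S ⊆ X ∧ Unseparated 𝒞 S ∧ PairwiseCompatible (restrictTo 𝒞 S)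

/-- `S` is a maximal ST-set: no ST-set properly contains it. -/
def IsMaxSTSet (X : Finset α) (𝒞 : Set (Finset α)) (S : Finset α) : Prop :=
  IsSTSet X 𝒞 S ∧ ∀ S', IsSTSet X 𝒞 S' → ¬ S ⊂ S'

/-- `(S₁, …, S_p)` is a maximal ST-set sequence of `𝒞`. -/
def IsMaxSTSeq : Finset α → Set (Finset α) → List (Finset α) → Prop
  | _, _, [] => True
  | X, 𝒞, S :: L => IsMaxSTSet X 𝒞 S ∧ IsMaxSTSeq (X \ S) (removeTaxa 𝒞 S) L

/-- `(S₁, …, S_p)` is an ST-set sequence of `𝒞` (empty ST-sets allowed). -/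
def IsSTSeq : Finset α → Set (Finset α) → List (Finset α) → Prop
  | _, _, [] => True
  | X, 𝒞, S :: L => IsSTSet X 𝒞 S ∧ IsSTSeq (X \ S) (removeTaxa 𝒞 S) L

def removeAll (𝒞 : Set (Finset α)) (L : List (Finset α)) : Set (Finset α) :=
  L.foldl removeTaxa 𝒞

/-- A maximal ST-set *tree* sequence: additionally the remaining clusters are pairwise
compatible. -/
def IsMaxSTTreeSeq (X : Finset α) (𝒞 : Set (Finset α)) (L : List (Finset α)) : Prop :=
  IsMaxSTSeq X 𝒞 L ∧ PairwiseCompatible (removeAll 𝒞 L)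

def IsSTTreeSeq (X : Finset α) (𝒞 : Set (Finset α)) (L : List (Finset α)) : Prop :=
  IsSTSeq X 𝒞 L ∧ PairwiseCompatible (removeAll 𝒞 L)

/-- The MST lower bound: minimum length of a maximal ST-set tree sequence of `𝒞`. -/
noncomputable def mstLB (X : Finset α) (𝒞 : Set (Finset α)) : ℕ :=
  sInf {p | ∃ L, IsMaxSTTreeSeq X 𝒞 L ∧ L.length = p}

/- Underlying undirected notions, biconnected components and the level of a network. -/

def uadj (N : Net α) (F : Finset (Fin N.n × Fin N.n)) (u v : Fin N.n) : Prop :=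
  (u, v) ∈ F ∨ (v, u) ∈ F

def verts (N : Net α) (F : Finset (Fin N.n × Fin N.n)) : Finset (Fin N.n) :=
  F.image Prod.fst ∪ F.image Prod.snd

def ConnOn (N : Net α) (F : Finset (Fin N.n × Fin N.n)) : Prop :=
  ∀ u ∈ verts N F, ∀ v ∈ verts N F, Relation.ReflTransGen (uadj N F) u v

def delVert (N : Net α) (F : Finset (Fin N.n × Fin N.n)) (v : Fin N.n) :
    Finset (Fin N.n × Fin N.n) :=
  F.filter fun e => e.1 ≠ v ∧ e.2 ≠ v

def HasCutNodeOn (N : Net α) (F : Finset (Fin N.n × Fin N.n)) : Prop :=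
  ∃ v ∈ verts N F, ∃ a ∈ verts N F, ∃ b ∈ verts N F, a ≠ v ∧ b ≠ v ∧
    ¬ Relation.ReflTransGen (uadj N (delVert N F v)) a b

/-- The (edge set of a) subgraph is biconnected: connected and without cut-nodes. -/
def Biconn (N : Net α) (F : Finset (Fin N.n × Fin N.n)) : Prop :=
  F.Nonempty ∧ ConnOn N F ∧ ¬ HasCutNodeOn N F

/-- `F` is a biconnected component of `N`: a maximal biconnected subgraph. -/
def IsBCC (N : Net α) (F : Finset (Fin N.n × Fin N.n)) : Prop :=
  F ⊆ N.E ∧ Biconn N F ∧ ∀ F', F' ⊆ N.E → Biconn N F' → F ⊆ F' → F' = F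

/-- Reticulation number of a biconnected component, indegrees computed within it. -/
def compRetic (N : Net α) (F : Finset (Fin N.n × Fin N.n)) : ℕ :=
  ∑ v ∈ verts N F, ((F.filter fun e => e.2 = v).card - 1)

/-- The level of `N`: the maximum reticulation number of a biconnected component. -/
noncomputable def level (N : Net α) : ℕ :=
  sSup {k | ∃ F, IsBCC N F ∧ compRetic N F = k}

def IsCutEdge (N : Net α) (e : Fin N.n × Fin N.n) : Prop :=
  e ∈ N.E ∧ ∃ a b : Fin N.n, ¬ Relation.ReflTransGen (uadj N (N.E.erase e)) a b

def IsCutNode (N : Net α) (v : Fin N.n) : Prop :=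
  ∃ a b : Fin N.n, a ≠ v ∧ b ≠ v ∧
    ¬ Relation.ReflTransGen (uadj N (delVert N N.E v)) a b

/-- `N` is simple: removal of any cut-node or cut-edge leaves at most one non-trivial
connected component (all remaining edges lie in a single component). -/
def IsSimpleNet (N : Net α) : Prop :=
  (∀ v : Fin N.n, IsCutNode N v → ∀ f ∈ delVert N N.E v, ∀ g ∈ delVert N N.E v,
      Relation.ReflTransGen (uadj N (delVert N N.E v)) f.1 g.1) ∧
  (∀ e : Fin N.n × Fin N.n, IsCutEdge N e → ∀ f ∈ N.E.erase e, ∀ g ∈ N.E.erase e,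
      Relation.ReflTransGen (uadj N (N.E.erase e)) f.1 g.1)

/-- The non-trivial ST-set `S` is under a cut-edge of `N`: `N` has a cut-edge `(u,v)`
such that the subnetwork rooted at `v` is a tree whose taxa set is `S` and which
represents the cluster set `𝒞 | S`. -/
def UnderCutEdge (𝒞 : Set (Finset α)) (N : Net α) (S : Finset α) : Prop :=
  ∃ e ∈ N.E, IsCutEdge N e ∧ N.clusterBelow e.2 = S ∧
    (∀ w : Fin N.n, N.Reaches e.2 w →
      (N.E.filter fun f => f.2 = w ∧ N.Reaches e.2 f.1).card ≤ 1) ∧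
    ∀ C ∈ restrictTo 𝒞 S, ∃ f ∈ N.E, N.Reaches e.2 f.1 ∧ N.clusterBelow f.2 = C

/-- The subnetwork of `N` rooted at `v` is exactly (isomorphic to) `T`. -/
def IsoSubnetAt (N : Net α) (v : Fin N.n) (T : Net α) : Prop :=
  ∃ g : Fin T.n → Fin N.n, Function.Injective g ∧
    Set.range g = {w | N.Reaches v w} ∧
    (∀ a b : Fin T.n, (a, b) ∈ T.E ↔ (g a, g b) ∈ N.E) ∧
    ∀ a : Fin T.n, T.IsLeaf a → N.label (g a) = T.label a

/-- `T` is a subtree below a reticulation (SBR) of `N`. -/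
def IsSBR (N T : Net α) : Prop :=
  ∃ v : Fin N.n, 2 ≤ N.indeg v ∧
    (∀ w : Fin N.n, N.Reaches v w → w ≠ v → N.indeg w < 2) ∧
    ((N.outdeg v = 1 ∧ ∃ c : Fin N.n, (v, c) ∈ N.E ∧ IsoSubnetAt N c T) ∨
     (N.outdeg v ≠ 1 ∧ IsoSubnetAt N v T))

/-- `T'` is a (not necessarily binary) refinement of `T`: a tree on `X` with
`Cl(T) ⊆ Cl(T')`. -/
def IsRefinement (X : Finset α) (T T' : Net α) : Prop :=
  IsPhyloTree X T' ∧ clSet T ⊆ clSet T'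

/-- `h⁰(𝒯)`: minimum reticulation number of a network on `X` displaying some
refinement of each tree of the family. -/
noncomputable def h0 (X : Finset α) {m : ℕ} (T : Fin m → Net α) : ℕ :=
  sInf {k | ∃ N : Net α, IsPhyloNet X N ∧
    (∀ i, ∃ T', IsRefinement X (T i) T' ∧ Displays N T') ∧ N.reticNum = k}

/-- `h⁻(𝒯)`: minimum reticulation number of a network on `X` displaying some *binary*
refinement of each tree of the family. -/
noncomputable def hminus (X : Finset α) {m : ℕ} (T : Fin m → Net α) : ℕ :=
  sInf {k | ∃ N : Net α, IsPhyloNet X N ∧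
    (∀ i, ∃ T', IsRefinement X (T i) T' ∧ IsBinary T' ∧ Displays N T') ∧ N.reticNum = k}

/-- `N` is consistent with the rooted triplet `xy|z`: it displays the binary tree on
`{x,y,z}` in which `{x,y}` is a cluster. -/
def ConsistentTriplet (N : Net α) (x y z : α) : Prop :=
  ∃ t : Net α, IsPhyloTree ({x, y, z} : Finset α) t ∧ IsBinary t ∧
    (∃ e ∈ t.E, t.clusterBelow e.2 = ({x, y} : Finset α)) ∧ Displays N t

/-- `r_tr(𝒯)`: minimum reticulation number of a network on `X` consistent with every
rooted triplet consistent with some tree of the family. -/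
noncomputable def rtr (X : Finset α) {m : ℕ} (T : Fin m → Net α) : ℕ :=
  sInf {k | ∃ N : Net α, IsPhyloNet X N ∧
    (∀ x y z : α, x ≠ y → y ≠ z → x ≠ z →
      (∃ i, ConsistentTriplet (T i) x y z) → ConsistentTriplet N x y z) ∧
    N.reticNum = k}

/-- `𝒞_{U → u}`: replace all elements of `U` in every cluster by the single taxon `u`. -/
def collapseTo (𝒞 : Set (Finset α)) (U : Finset α) (u : α) : Set (Finset α) :=
  {D | ∃ C ∈ 𝒞, D = if (C ∩ U).Nonempty then (C \ U) ∪ {u} else C}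

section Helpers

open Relation

def EA {n : ℕ} (E : Finset (Fin n × Fin n)) (a b : Fin n) : Prop := (a, b) ∈ E

def RP {n : ℕ} (E : Finset (Fin n × Fin n)) (p : Fin n → Fin n) (a b : Fin n) : Prop :=
  (a, b) ∈ E ∧ p b = a

def ind {n : ℕ} (E : Finset (Fin n × Fin n)) (v : Fin n) : ℕ :=
  (E.filter fun e => e.2 = v).card

def Rep {β : Type} {n : ℕ} (E : Finset (Fin n × Fin n)) (l : β → Fin n) (X C : Finset β) : Prop :=
  ∃ p : Fin n → Fin n, (∀ a w, (a, w) ∈ E → (p w, w) ∈ E) ∧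
    ∃ u, ∀ x, x ∈ C ↔ x ∈ X ∧ ReflTransGen (RP E p) u (l x)

theorem ind_le_one {n : ℕ} {E : Finset (Fin n × Fin n)} {v a b : Fin n} (h : ind E v ≤ 1)
    (ha : (a, v) ∈ E) (hb : (b, v) ∈ E) : a = b := by
  unfold ind at h
  rw [Finset.card_le_one] at h
  have := h (a, v) (by simp [ha]) (b, v) (by simp [hb])
  simpa using this

theorem RP_mono {n : ℕ} {E : Finset (Fin n × Fin n)} {p : Fin n → Fin n} {a b : Fin n}
    (h : ReflTransGen (RP E p) a b) : ReflTransGen (EA E) a b :=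
  ReflTransGen.mono (fun _ _ h => h.1) _ _ h

theorem lemA {n : ℕ} {E : Finset (Fin n × Fin n)} {R : Fin n → Fin n → Prop} {v : Fin n}
    (hR : ∀ a b, R a b → (a, b) ∈ E)
    (hv : ∀ w, TransGen (EA E) v w → ind E w ≤ 1) {u y : Fin n}
    (hu : ReflTransGen R u y) : ReflTransGen (EA E) v y →
    ReflTransGen (EA E) v u ∨ ReflTransGen R u v := by
  induction hu with
  | refl => intro h; exact Or.inl h
  | @tail b c hub hbc ih =>
    intro h
    rcases ReflTransGen.cases_tail h with h | ⟨d, hvd, hdc⟩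
    · subst h; exact Or.inr (hub.tail hbc)
    · have : d = b := ind_le_one (hv c (TransGen.tail' hvd hdc)) hdc (hR _ _ hbc)
      subst this
      exact ih hvd

theorem lemB {n : ℕ} {E : Finset (Fin n × Fin n)} {p : Fin n → Fin n} {v : Fin n}
    (hp : ∀ a w, (a, w) ∈ E → (p w, w) ∈ E)
    (hv : ∀ w, TransGen (EA E) v w → ind E w ≤ 1) {y : Fin n}
    (h : ReflTransGen (EA E) v y) : ReflTransGen (RP E p) v y := by
  induction h with
  | refl => exact .refl
  | @tail b c hvb hbc ih =>
    exact ih.tail ⟨hbc, ind_le_one (hv c (TransGen.tail' hvb hbc)) (hp _ _ hbc) hbc⟩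

theorem lemSwitch {n : ℕ} {E : Finset (Fin n × Fin n)} {R₁ R₂ : Fin n → Fin n → Prop} {v : Fin n}
    (hR : ∀ a b, R₁ a b → (a, b) ∈ E) (h12 : ∀ a b, b ≠ v → R₁ a b → R₂ a b) {u y : Fin n}
    (h : ReflTransGen R₁ u y) : ¬ ReflTransGen (EA E) v y → ReflTransGen R₂ u y := by
  induction h with
  | refl => intro _; exact .refl
  | @tail b c hub hbc ih =>
    intro hy
    have hcv : c ≠ v := by rintro rfl; exact hy .refl
    exact (ih (fun hb => hy (hb.tail (hR _ _ hbc)))).tail (h12 _ _ hcv hbc)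

/-- two vertices in tree-like part -/
theorem lemLam {β : Type} [DecidableEq β] {n : ℕ} {E : Finset (Fin n × Fin n)} {l : β → Fin n}
    {X A B : Finset β} {u₁ u₂ : Fin n}
    (h1 : ∀ w, TransGen (EA E) u₁ w → ind E w ≤ 1)
    (hA : ∀ x, x ∈ A ↔ x ∈ X ∧ ReflTransGen (EA E) u₁ (l x))
    (hB : ∀ x, x ∈ B ↔ x ∈ X ∧ ReflTransGen (EA E) u₂ (l x)) : Compatible A B := by
  by_cases he : A ∩ B = ∅
  · exact Or.inl he
  · obtain ⟨x, hx⟩ := Finset.nonempty_iff_ne_empty.mpr he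
    rw [Finset.mem_inter, hA, hB] at hx
    rcases lemA (fun _ _ h => h) h1 hx.2.2 hx.1.2 with h | h
    · right; right; intro y hy
      rw [hB] at hy; rw [hA]; exact ⟨hy.1, h.trans hy.2⟩
    · right; left; intro y hy
      rw [hA] at hy; rw [hB]; exact ⟨hy.1, h.trans hy.2⟩

theorem core {β : Type} [DecidableEq β] {n : ℕ} (l : β → Fin n) : ∀ (k : ℕ)
    (E : Finset (Fin n × Fin n)), (∀ v, ¬ TransGen (EA E) v v) → ∑ v, (ind E v - 1) = k →
    ∀ (X : Finset β) (𝒞 : Set (Finset β)), (∀ C ∈ 𝒞, Rep E l X C) →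
    ∃ L : List (Finset β), IsSTTreeSeq X 𝒞 L ∧ L.length = k := by
  intro k
  induction k with
  | zero =>
    intro E hac hk X 𝒞 hrep
    refine ⟨[], ⟨trivial, ?_⟩, rfl⟩
    have hind : ∀ w, ind E w ≤ 1 := by
      intro w
      have := (Finset.sum_eq_zero_iff.mp hk) w (Finset.mem_univ _)
      omega
    have key : ∀ C ∈ 𝒞, ∃ u, ∀ x, x ∈ C ↔ x ∈ X ∧ ReflTransGen (EA E) u (l x) := by
      intro C hC
      obtain ⟨p, hp, u, hu⟩ := hrep C hC
      refine ⟨u, fun x => ?_⟩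
      rw [hu]
      exact and_congr_right fun _ => ⟨RP_mono, lemB hp (fun w _ => hind w)⟩
    intro A hA B hB
    obtain ⟨u₁, h1⟩ := key A hA
    obtain ⟨u₂, h2⟩ := key B hB
    exact lemLam (fun w _ => hind w) h1 h2
  | succ k ih =>
    intro E hac hk X 𝒞 hrep
    have hex : ∃ v, 2 ≤ ind E v := by
      by_contra hcon
      push Not at hcon
      have : ∑ v, (ind E v - 1) = 0 := Finset.sum_eq_zero fun v _ => by have := hcon v; omega
      omega
    have hwf : WellFounded (fun a b => TransGen (EA E) b a) := by
      haveI : IsTrans (Fin n) (fun a b => TransGen (EA E) b a) := ⟨fun a b c h1 h2 => h2.trans h1⟩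
      haveI : Std.Irrefl (fun a b : Fin n => TransGen (EA E) b a) := ⟨fun a h => hac a h⟩
      exact Finite.wellFounded_of_trans_of_irrefl _
    obtain ⟨v, hv2, hvmin⟩ := hwf.has_min {v | 2 ≤ ind E v} hex
    have hlow : ∀ w, TransGen (EA E) v w → ind E w ≤ 1 := by
      intro w hw
      by_contra hcon
      exact hvmin w (by simp only [Set.mem_setOf_eq]; omega) hw
    have hlow' : ∀ u, ReflTransGen (EA E) v u → ∀ w, TransGen (EA E) u w → ind E w ≤ 1 :=
      fun u hu w hw => hlow w (TransGen.trans_right hu hw)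
    obtain ⟨e, he, f, hf, hef⟩ := Finset.one_lt_card.mp (show 1 < (E.filter fun e => e.2 = v).card from hv2)
    obtain ⟨a, a2⟩ := e
    obtain ⟨b, b2⟩ := f
    simp only [Finset.mem_filter] at he hf
    obtain ⟨haE, rfl⟩ := he
    obtain ⟨hbE, rfl⟩ := hf
    rename' b2 => v
    have hab : b ≠ a := fun h => hef (by rw [h])
    set E' := E.erase (a, v) with hE'
    have hsub : ∀ {c w}, (c, w) ∈ E' → (c, w) ∈ E := fun h => Finset.mem_of_mem_erase h
    set S : Finset β := X.filter (fun x => ReflTransGen (EA E) v (l x)) with hS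
    have memS : ∀ x, x ∈ S ↔ x ∈ X ∧ ReflTransGen (EA E) v (l x) := by
      intro x; rw [hS, Finset.mem_filter]
    -- trichotomy
    have tri : ∀ C ∈ 𝒞, C ∩ S = ∅ ∨ S ⊆ C ∨
        ∃ u, ReflTransGen (EA E) v u ∧ ∀ x, x ∈ C ↔ x ∈ X ∧ ReflTransGen (EA E) u (l x) := by
      intro C hC
      obtain ⟨p, hp, u, hu⟩ := hrep C hC
      by_cases hvu : ReflTransGen (EA E) v u
      · right; right
        refine ⟨u, hvu, fun x => ?_⟩
        rw [hu]
        exact and_congr_right fun _ => ⟨RP_mono, lemB hp (hlow' u hvu)⟩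
      · by_cases he : C ∩ S = ∅
        · exact Or.inl he
        · right; left
          obtain ⟨x, hx⟩ := Finset.nonempty_iff_ne_empty.mpr he
          rw [Finset.mem_inter, hu, memS] at hx
          rcases lemA (R := RP E p) (fun _ _ h => h.1) hlow hx.1.2 hx.2.2 with h | h
          · exact absurd h hvu
          · intro y hy
            rw [memS] at hy; rw [hu]
            exact ⟨hy.1, h.trans (lemB hp hlow hy.2)⟩
    have hsubC : ∀ (C : Finset β) u, ReflTransGen (EA E) v u →
        (∀ x, x ∈ C ↔ x ∈ X ∧ ReflTransGen (EA E) u (l x)) → C ⊆ S := by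
      intro C u hvu hu x hx
      rw [hu] at hx; rw [memS]; exact ⟨hx.1, hvu.trans hx.2⟩
    have hST : IsSTSet X 𝒞 S := by
      refine ⟨Finset.filter_subset _ _, ?_, ?_⟩
      · intro C hC
        rcases tri C hC with h | h | ⟨u, hvu, hu⟩
        · exact Or.inl h
        · exact Or.inr (Or.inr h)
        · exact Or.inr (Or.inl (hsubC C u hvu hu))
      · rintro A ⟨hAne, C, hC, rfl⟩ B ⟨hBne, D, hD, rfl⟩
        rcases tri C hC with h | h | ⟨u, hvu, hu⟩
        · rw [h] at hAne; exact absurd hAne (by simp)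
        · right; right
          intro x hx
          rw [Finset.mem_inter] at hx ⊢
          exact ⟨h hx.2, hx.2⟩
        · rcases tri D hD with h | h | ⟨u', hvu', hu'⟩
          · rw [h] at hBne; exact absurd hBne (by simp)
          · right; left
            intro x hx
            rw [Finset.mem_inter] at hx ⊢
            exact ⟨h hx.2, hx.2⟩
          · rw [Finset.inter_eq_left.mpr (hsubC C u hvu hu),
              Finset.inter_eq_left.mpr (hsubC D u' hvu' hu')]
            exact lemLam (hlow' u hvu) hu hu'
    have hac' : ∀ v, ¬ TransGen (EA E') v v :=
      fun w hw => hac w (TransGen.mono (fun _ _ h => hsub h) _ _ hw)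
    have hbE' : (b, v) ∈ E' := by
      rw [hE', Finset.mem_erase]; exact ⟨fun h => hab (by simpa using h), hbE⟩
    have hk' : ∑ w, (ind E' w - 1) = k := by
      have h1 : ind E' v = ind E v - 1 := by
        unfold ind
        rw [hE', Finset.filter_erase, Finset.card_erase_of_mem (by simp [haE])]
      have h2 : ∀ w, w ≠ v → ind E' w = ind E w := by
        intro w hw
        unfold ind
        rw [hE', Finset.filter_erase, Finset.erase_eq_of_notMem]
        simp [Ne.symm hw]
      rw [← Finset.add_sum_erase _ _ (Finset.mem_univ v)] at hk ⊢
      rw [Finset.sum_congr rfl (fun w hw => by rw [h2 w (Finset.ne_of_mem_erase hw)]), h1]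
      have : 2 ≤ ind E v := hv2
      omega
    have hrep' : ∀ C ∈ removeTaxa 𝒞 S, Rep E' l (X \ S) C := by
      rintro _ ⟨-, C, hC, rfl⟩
      obtain ⟨p, hp, u, hu⟩ := hrep C hC
      refine ⟨Function.update p v b, ?_, u, ?_⟩
      · intro c w hcw
        by_cases hw : w = v
        · subst hw; simpa using hbE'
        · rw [Function.update_of_ne hw, hE', Finset.mem_erase]
          exact ⟨fun h => hw (by simpa using (Prod.ext_iff.mp h).2), hp c w (hsub hcw)⟩
      · intro x
        rw [Finset.mem_sdiff, Finset.mem_sdiff, hu, and_right_comm]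
        refine and_congr_right fun hx => ?_
        have hnr : ¬ ReflTransGen (EA E) v (l x) := fun h => hx.2 ((memS x).mpr ⟨hx.1, h⟩)
        constructor
        · intro h
          refine lemSwitch (R₁ := RP E p) (fun _ _ h => h.1) ?_ h hnr
          rintro c w hw ⟨h1, h2⟩
          refine ⟨?_, by rw [Function.update_of_ne hw]; exact h2⟩
          rw [hE', Finset.mem_erase]
          exact ⟨fun h => hw (by simpa using (Prod.ext_iff.mp h).2), h1⟩
        · intro h
          refine lemSwitch (R₁ := RP E' (Function.update p v b)) (fun _ _ h => hsub h.1) ?_ h hnr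
          rintro c w hw ⟨h1, h2⟩
          rw [Function.update_of_ne hw] at h2
          exact ⟨hsub h1, h2⟩
    obtain ⟨L, ⟨hL1, hL2⟩, hLk⟩ := ih E' hac' hk' (X \ S) (removeTaxa 𝒞 S) hrep'
    exact ⟨S :: L, ⟨⟨hST, hL1⟩, hL2⟩, by simp [hLk]⟩

theorem chain_reach {β : Type} {R : β → β → Prop} : ∀ (q : List β) (a z : β),
    (a :: q).IsChain R → (a :: q).getLast? = some z → ReflTransGen R a z := by
  intro q
  induction q with
  | nil => intro a z _ h; simp at h; subst h; exact .refl
  | cons b q ih =>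
    intro a z hc hz
    rw [List.isChain_cons_cons] at hc
    exact ReflTransGen.head hc.1 (ih b z hc.2 (by simpa using hz))

theorem chain_back {β : Type} {R : β → β → Prop} (hR : ∀ a b c, R a c → R b c → a = b) (y : β) :
    ∀ (q : List β) (a z : β),
    (a :: q).IsChain R → (a :: q).getLast? = some z → ReflTransGen R y z →
      y ∈ q ∨ ReflTransGen R y a := by
  intro q
  induction q with
  | nil => intro a z _ h hy; simp at h; subst h; exact Or.inr hy
  | cons b q ih =>
    intro a z hc hz hy
    rw [List.isChain_cons_cons] at hc
    rcases ih b z hc.2 (by simpa using hz) hy with h | h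
    · left; simp [h]
    · rcases ReflTransGen.cases_tail h with h | ⟨d, hvd, hdc⟩
      · left; simp [h]
      · right; rw [hR a d b hc.1 hdc]; exact hvd

theorem mem_internals {β : Type} (q : List β) (a z w : β) (hz : (a :: q).getLast? = some z)
    (hw : w ∈ q) : w = z ∨ w ∈ internals (a :: q) := by
  unfold internals
  rcases List.eq_nil_or_concat q with rfl | ⟨q', c, rfl⟩
  · simp at hw
  · have : c = z := by
      have : (a :: (q' ++ [c])).getLast? = some c := by
        rw [← List.cons_append, List.getLast?_concat]
      simpa [this] using hz
    simp at hw ⊢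
    rcases hw with h | h
    · right; exact h
    · left; rw [h, this]

theorem acyclic_nodup {β : Type} {R : β → β → Prop} (hac : ∀ v, ¬ TransGen R v v) (q : List β)
    (hc : q.IsChain R) : q.Nodup := by
  have h1 : q.IsChain (TransGen R) := hc.imp (fun _ _ h => TransGen.single h)
  have h2 : q.Pairwise (TransGen R) := List.isChain_iff_pairwise.mp h1
  exact h2.imp (fun {a b} h => by rintro rfl; exact hac _ h)

theorem rep_of_represents {β : Type} [DecidableEq β] {X C : Finset β} {N : Net β}
    (hN : IsPhyloNet X N) (l : β → Fin N.n)
    (hl : ∀ x ∈ X, N.IsLeaf (l x) ∧ N.label (l x) = x)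
    (h : RepresentsCluster X N C) : Rep N.E l X C := by
  obtain ⟨T, ⟨⟨hTac, ⟨r, hr, hruniq⟩, -, -, hTbij⟩, hT0⟩, ⟨φ, hφ, hφleaf, P, hP1, hP2, hP3⟩,
    e₀, he₀, rfl⟩ := h
  obtain ⟨hNac, -, -, -, hNbij⟩ := hN
  have hind : ∀ w, ind T.E w ≤ 1 := by
    intro w
    have : T.indeg w - 1 = 0 := (Finset.sum_eq_zero_iff.mp hT0) w (Finset.mem_univ _)
    have h2 : T.indeg w = ind T.E w := rfl
    omega
  -- root reaches all
  have hroot : ∀ t, ReflTransGen (EA T.E) r t := by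
    have hwf : WellFounded (TransGen T.Adj) := by
      haveI : IsTrans (Fin T.n) (TransGen T.Adj) := ⟨fun a b c h1 h2 => h1.trans h2⟩
      haveI : Std.Irrefl (TransGen T.Adj) := ⟨fun a h => hTac a h⟩
      exact Finite.wellFounded_of_trans_of_irrefl _
    intro t
    induction t using hwf.induction with
    | _ t ih =>
      by_cases h0 : T.indeg t = 0
      · rw [hruniq t h0]
      · unfold Net.indeg at h0
        obtain ⟨⟨c, d⟩, hc⟩ := Finset.card_pos.mp (Nat.pos_of_ne_zero h0)
        simp only [Finset.mem_filter] at hc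
        obtain ⟨hc, rfl⟩ := hc
        exact (ih c (TransGen.single hc)).tail hc
  -- shape of the paths
  have hshape : ∀ e ∈ T.E, ∃ q, P e = φ e.1 :: q ∧ (φ e.1 :: q).getLast? = some (φ e.2) ∧
      (φ e.1 :: q).IsChain N.Adj := by
    intro e he
    obtain ⟨h1, h2, h3, h4⟩ := hP1 e he
    cases hq : P e with
    | nil => rw [hq] at h1; simp at h1
    | cons c q =>
      rw [hq] at h1 h2 h3
      simp at h1
      subst h1
      exact ⟨q, rfl, h2, h3⟩
  let F : Fin N.n → Fin N.n → Prop := fun a w =>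
    ∃ e ∈ T.E, ∃ i, (P e)[i]? = some a ∧ (P e)[i+1]? = some w
  have hFloc : ∀ e ∈ T.E, ∀ i w, (P e)[i+1]? = some w → w = φ e.2 ∨ w ∈ internals (P e) := by
    intro e he i w hw
    obtain ⟨q, hq, hlast, -⟩ := hshape e he
    rw [hq] at hw ⊢
    rw [List.getElem?_cons_succ] at hw
    exact mem_internals q _ _ w hlast (List.mem_of_getElem? hw)
  have hFuniq : ∀ a b w, F a w → F b w → a = b := by
    rintro a b w ⟨e, he, i, hi1, hi2⟩ ⟨f, hf, j, hj1, hj2⟩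
    have hef : e = f := by
      by_contra hne
      rcases hFloc e he i w hi2 with h | h <;> rcases hFloc f hf j w hj2 with h' | h'
      · have h3 : e.2 = f.2 := hφ (h.symm.trans h')
        obtain ⟨e1, e2⟩ := e
        obtain ⟨f1, f2⟩ := f
        simp only at h3
        subst h3
        exact hne (by rw [ind_le_one (hind e2) he hf])
      · exact hP2 f hf w h' ⟨_, h.symm⟩
      · exact hP2 e he w h ⟨_, h'.symm⟩
      · exact hP3 e he f hf hne w h h'
    subst hef
    have hnd : (P e).Nodup := acyclic_nodup hNac _ (hP1 e he).2.2.1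
    have hlt : i + 1 < (P e).length := (List.getElem?_eq_some_iff.mp hi2).1
    have hij : i + 1 = j + 1 := (List.getElem?_inj hlt hnd).mp (hi2.trans hj2.symm)
    have : i = j := by omega
    subst this
    rw [hi1] at hj1
    simpa using hj1
  have hFE : ∀ a w, F a w → (a, w) ∈ N.E := by
    rintro a w ⟨e, he, i, hi1, hi2⟩
    have hc : (P e).IsChain N.Adj := (hP1 e he).2.2.1
    obtain ⟨h2, h2'⟩ := List.getElem?_eq_some_iff.mp hi2
    obtain ⟨h1, h1'⟩ := List.getElem?_eq_some_iff.mp hi1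
    have := List.isChain_iff_getElem.mp hc i h2
    rw [h1', h2'] at this
    exact this
  have hpex : ∀ w, ∃ c, (∀ a, F a w → c = a) ∧ (∀ a, (a, w) ∈ N.E → (c, w) ∈ N.E) := by
    intro w
    by_cases h1 : ∃ a, F a w
    · obtain ⟨a, ha⟩ := h1
      exact ⟨a, fun b hb => hFuniq a b w ha hb, fun _ _ => hFE _ _ ha⟩
    · by_cases h2 : ∃ a, (a, w) ∈ N.E
      · obtain ⟨a, ha⟩ := h2
        exact ⟨a, fun b hb => absurd ⟨b, hb⟩ h1, fun _ _ => ha⟩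
      · exact ⟨w, fun b hb => absurd ⟨b, hb⟩ h1, fun b hb => absurd ⟨b, hb⟩ h2⟩
  choose p hp1 hp2 using hpex
  have hchain : ∀ e ∈ T.E, (P e).IsChain (RP N.E p) := by
    intro e he
    rw [List.isChain_iff_getElem]
    intro i hi
    have hF : F ((P e)[i]) ((P e)[i+1]) :=
      ⟨e, he, i, List.getElem?_eq_getElem _, List.getElem?_eq_getElem _⟩
    exact ⟨hFE _ _ hF, hp1 _ _ hF⟩
  have hstep : ∀ e ∈ T.E, ReflTransGen (RP N.E p) (φ e.1) (φ e.2) := by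
    intro e he
    obtain ⟨q, hq, hlast, -⟩ := hshape e he
    have := hchain e he
    rw [hq] at this
    exact chain_reach q _ _ this hlast
  have hfwd : ∀ s t, ReflTransGen (EA T.E) s t → ReflTransGen (RP N.E p) (φ s) (φ t) := by
    intro s t h
    induction h with
    | refl => exact .refl
    | @tail b c _ hbc ih => exact ih.trans (hstep (b, c) hbc)
  have hleft : ∀ a b c, RP N.E p a c → RP N.E p b c → a = b :=
    fun a b c h1 h2 => h1.2.symm.trans h2.2
  have hbwd : ∀ t s, ReflTransGen (RP N.E p) (φ t) (φ s) → ReflTransGen (EA T.E) t s := by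
    intro t s
    have hrs := hroot s
    induction hrs with
    | refl =>
      intro h
      have h2 := hfwd r t (hroot t)
      rcases reflTransGen_iff_eq_or_transGen.mp h with h3 | h3
      · rw [hφ h3]
      · exfalso
        exact hNac (φ t) (TransGen.mono (fun _ _ h => h.1) _ _ (TransGen.trans_left h3 h2))
    | @tail s' s _ hs ih =>
      intro h
      obtain ⟨q, hq, hlast, -⟩ := hshape (s', s) hs
      have hc := hchain (s', s) hs
      rw [hq] at hc
      rcases chain_back hleft (φ t) q _ _ hc hlast h with h1 | h1
      · rcases mem_internals q _ _ _ hlast h1 with h2 | h2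
        · rw [hφ h2]
        · rw [← hq] at h2
          exact absurd ⟨t, rfl⟩ (hP2 _ hs _ h2)
      · exact (ih h1).tail hs
  refine ⟨p, fun a w h => hp2 w a h, φ e₀.2, fun x => ?_⟩
  have hφl : ∀ t, T.IsLeaf t → φ t = l (T.label t) := by
    intro t ht
    have hX : T.label t ∈ X := by simpa using hTbij.mapsTo ht
    obtain ⟨h1, h2⟩ := hφleaf t ht
    obtain ⟨h3, h4⟩ := hl _ hX
    exact hNbij.injOn h1 h3 (h2.trans h4.symm)
  unfold Net.clusterBelow
  simp only [Finset.mem_image, Finset.mem_filter, Finset.mem_univ, true_and]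
  constructor
  · rintro ⟨t, ⟨h1, h2⟩, rfl⟩
    refine ⟨by simpa using hTbij.mapsTo h2, ?_⟩
    rw [← hφl t h2]
    exact hfwd _ _ h1
  · rintro ⟨hx, h⟩
    obtain ⟨t, ht, rfl⟩ := hTbij.surjOn (show x ∈ (X : Set β) from hx)
    rw [← hφl t ht] at h
    exact ⟨t, ⟨hbwd _ _ h, ht⟩, rfl⟩

end Helpers

/-- If the network `N` represents the cluster set `𝒞` on `X`, then
there is an ST-set tree sequence of `𝒞` (empty ST-sets allowed) of length exactly
`r(N)`. -/
theorem exists_st_tree_seq_of_represents {α : Type} [DecidableEq α] (X : Finset α)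
    (𝒞 : Set (Finset α)) (h𝒞 : IsClusterSet X 𝒞)
    (N : Net α) (hN : IsPhyloNet X N) (hrep : RepresentsSet X N 𝒞) :
    ∃ L : List (Finset α), IsSTTreeSeq X 𝒞 L ∧ L.length = N.reticNum := by
  have hne : Nonempty (Fin N.n) := ⟨hN.2.1.choose⟩
  have hl : ∃ l : α → Fin N.n, ∀ x ∈ X, N.IsLeaf (l x) ∧ N.label (l x) = x := by
    have : ∀ x, ∃ v : Fin N.n, x ∈ X → N.IsLeaf v ∧ N.label v = x := by
      intro x
      by_cases hx : x ∈ X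
      · obtain ⟨v, hv, hv'⟩ := hN.2.2.2.2.surjOn (show x ∈ (X : Set α) from hx)
        exact ⟨v, fun _ => ⟨hv, hv'⟩⟩
      · exact ⟨hne.some, fun h => absurd h hx⟩
    choose l hl using this
    exact ⟨l, hl⟩
  obtain ⟨l, hl⟩ := hl
  exact core l N.reticNum N.E hN.1 rfl X 𝒞 fun C hC => rep_of_represents hN l hl (hrep C hC)

end Phylo
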